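/- Let R be a commutative ring and n a positive natural number whose image in R is a unit. Regard the Laurent polynomial ring R[T,T⁻¹] as an algebra over itself via the ring endomorphism determined by T ↦ Tⁿ (equivalently, the ring endomorphism of AddMonoidAlgebra R ℤ induced by the additive map ℤ → ℤ, z ↦ n·z on exponents). Then this algebra is étale: it is formally étale and of finite presentation over R[T,T⁻¹]. -/

import Mathlib

open Polynomial in
/-- The standard étale pair `(X ^ n - T, 1)` over `R[T,T⁻¹]`. -/
noncomputable def laurentPair (R : Type*) [CommRing R] (n : ℕ) (hn : 0 < n)
    (hu : IsUnit (n : R)) : StandardEtalePair (LaurentPolynomial R) where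
  f := X ^ n - C (LaurentPolynomial.T 1)
  monic_f := monic_X_pow_sub_C _ hn.ne'
  g := 1
  cond := by
    obtain ⟨v, hv⟩ := hu.exists_right_inv
    refine ⟨C (LaurentPolynomial.C v * LaurentPolynomial.T (-1)) * X,
      - C (LaurentPolynomial.T (-1) : LaurentPolynomial R), 0, ?_⟩
    have h1 : (C (LaurentPolynomial.T 1) * C (LaurentPolynomial.T (-1)) :
        (LaurentPolynomial R)[X]) = 1 := by
      rw [← C_mul, ← LaurentPolynomial.T_add]; simp
    have h2 : ((n : (LaurentPolynomial R)[X]) * C (LaurentPolynomial.C v)) = 1 := by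
      have := congrArg (fun r => (C (LaurentPolynomial.C r) : (LaurentPolynomial R)[X])) hv
      simpa using this
    obtain ⟨m, rfl⟩ : ∃ m, n = m + 1 := ⟨n - 1, by omega⟩
    simp only [derivative_sub, derivative_X_pow, derivative_C, C_mul, map_natCast,
      Nat.add_sub_cancel, sub_zero, pow_zero]
    linear_combination (X ^ (m + 1) * C (LaurentPolynomial.T (-1))) * h2 + h1

theorem laurent_ringHom_ext {R S : Type*} [CommRing R] [CommRing S]
    (f₁ f₂ : LaurentPolynomial R →+* S)
    (h1 : ∀ r, f₁ (LaurentPolynomial.C r) = f₂ (LaurentPolynomial.C r))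
    (h2 : f₁ (LaurentPolynomial.T 1) = f₂ (LaurentPolynomial.T 1)) : f₁ = f₂ :=
  AddMonoidAlgebra.ringHom_ext' (RingHom.ext h1) (MonoidHom.ext_mint h2)

theorem laurent_etale_aux (R : Type*) [CommRing R] (n : ℕ) (hn : 0 < n)
    (hu : IsUnit (n : R)) (B : Type*) [CommRing B] [Algebra (LaurentPolynomial R) B]
    (e : LaurentPolynomial R ≃+* B) (φ : LaurentPolynomial R →+* LaurentPolynomial R)
    (φC : ∀ r : R, φ (LaurentPolynomial.C r) = LaurentPolynomial.C r)
    (φT : ∀ k : ℤ, φ (LaurentPolynomial.T k) = LaurentPolynomial.T (n * k))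
    (hB : ∀ a, algebraMap (LaurentPolynomial R) B a = e (φ a)) :
    Algebra.Etale (LaurentPolynomial R) B := by
  let P := laurentPair R n hn hu
  have hm : P.HasMap (e (LaurentPolynomial.T 1)) := by
    refine ⟨?_, by simp [P, laurentPair]⟩
    simp only [P, laurentPair, map_sub, Polynomial.aeval_X_pow, Polynomial.aeval_C, hB, φT, ← map_pow,
      LaurentPolynomial.T_pow, sub_self]
  have hX : P.X ^ n = algebraMap (LaurentPolynomial R) P.Ring (LaurentPolynomial.T 1) := by
    have := P.hasMap_X.1
    have hf : P.f = Polynomial.X ^ n - Polynomial.C (LaurentPolynomial.T 1) := rfl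
    rw [hf, map_sub, Polynomial.aeval_X_pow, Polynomial.aeval_C] at this
    exact sub_eq_zero.mp this
  have hXu : IsUnit P.X := by
    rw [← isUnit_pow_iff hn.ne', hX]
    exact (LaurentPolynomial.isUnit_T 1).map _
  obtain ⟨x, hx⟩ := hXu
  let g : LaurentPolynomial R →+* P.Ring :=
    LaurentPolynomial.eval₂ ((algebraMap (LaurentPolynomial R) P.Ring).comp LaurentPolynomial.C) x
  have gC (r : R) : g (LaurentPolynomial.C r) = algebraMap _ _ (LaurentPolynomial.C r) := by
    simp [g]
  have gT (k : ℤ) : g (LaurentPolynomial.T k) = (x ^ k : P.Ringˣ) := by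
    simp [g]
  have hgφ : g.comp φ = algebraMap (LaurentPolynomial R) P.Ring := by
    apply laurent_ringHom_ext
    · intro r; simp [φC, gC]
    · simp [φT, gT, hx, hX]
  let f : P.Ring →ₐ[LaurentPolynomial R] B := P.lift _ hm
  let g' : B →ₐ[LaurentPolynomial R] P.Ring :=
    { g.comp e.symm.toRingHom with
      commutes' := fun a => by
        simpa [hB] using RingHom.congr_fun hgφ a }
  have hg' (b) : g' b = g (e.symm b) := rfl
  have h1 : f.comp g' = AlgHom.id _ _ := by
    have : (f.toRingHom.comp g) = e.toRingHom := by
      apply laurent_ringHom_ext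
      · intro r
        simp [gC, hB, φC]
      · simp [gT, hx, f]
    ext b
    simpa [hg'] using RingHom.congr_fun this (e.symm b)
  have h2 : g'.comp f = AlgHom.id _ _ := by
    apply P.hom_ext
    simp [f, hg', gT, hx]
  exact Algebra.Etale.of_equiv (AlgEquiv.ofAlgHom f g' h1 h2)

theorem laurent_power_map_etale (R : Type*) [CommRing R] (n : ℕ) (hn : 0 < n)
    (hu : IsUnit (n : R)) :
    @Algebra.Etale (LaurentPolynomial R) (LaurentPolynomial R) _ _
      ((AddMonoidAlgebra.mapDomainRingHom R (AddMonoidHom.mulLeft (n : ℤ))).toAlgebra) := by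
  refine @laurent_etale_aux R _ n hn hu (LaurentPolynomial R) _
    ((AddMonoidAlgebra.mapDomainRingHom R (AddMonoidHom.mulLeft (n : ℤ))).toAlgebra)
    (RingEquiv.refl _) (AddMonoidAlgebra.mapDomainRingHom R (AddMonoidHom.mulLeft (n : ℤ)))
    (fun r => ?_) (fun k => ?_) (fun _ => rfl)
  · refine (AddMonoidAlgebra.mapDomain_single (f := AddMonoidHom.mulLeft (n : ℤ))).trans ?_
    exact congrArg (fun z : ℤ => AddMonoidAlgebra.single z r) (mul_zero (n : ℤ))
  · exact AddMonoidAlgebra.mapDomain_single (f := AddMonoidHom.mulLeft (n : ℤ))
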